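/- Let Q₀ be the presentation ⟨a, b, t | a^b a⁻², [a,t]⟩. There is a constant C > 0, depending only on Q₀, such that every null-homotopic word w over Q₀ can be converted to the empty word by free reductions, free expansions and applications of relators of Q₀ with every intermediate word of length at most C·ℓ(w) + C; that is, the filling length function of Q₀ admits a linear upper bound. -/

import Mathlib

/-! Words over an alphabet `A`: a letter `(x, true)` is the generator `x`,
and `(x, false)` is its formal inverse `x⁻¹`. -/

/-- A word over the alphabet `A ∪ A⁻¹`. -/
abbrev Word (A : Type*) := List (A × Bool)

namespace Word

/-- The formal inverse of a word. -/
def inv {A : Type*} (w : Word A) : Word A := (w.map fun p => (p.1, !p.2)).reverse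

/-- `w'` is a cyclic conjugate (cyclic permutation) of `w`. -/
def IsCyclicConj {A : Type*} (w w' : Word A) : Prop :=
  ∃ u v : Word A, w = u ++ v ∧ w' = v ++ u

end Word

/-- Moves (i)–(iii) on words with respect to a set `R` of relator words:
free reduction, free expansion, and application of a relator (replace a subword `u`
by `v` where some cyclic conjugate of `u * v⁻¹` lies in `R ∪ R⁻¹`). -/
inductive Move {A : Type*} (R : Set (Word A)) : Word A → Word A → Prop
  | freeReduce (u v : Word A) (x : A) (b : Bool) :
      Move R (u ++ (x, b) :: (x, !b) :: v) (u ++ v)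
  | freeExpand (u v : Word A) (x : A) (b : Bool) :
      Move R (u ++ v) (u ++ (x, b) :: (x, !b) :: v)
  | relator (p q u v z : Word A)
      (hz : Word.IsCyclicConj (u ++ Word.inv v) z) (hR : z ∈ R ∨ Word.inv z ∈ R) :
      Move R (p ++ u ++ q) (p ++ v ++ q)

/-- Moves (i)–(iv): moves (i)–(iii) together with cyclic conjugation. -/
inductive MoveC {A : Type*} (R : Set (Word A)) : Word A → Word A → Prop
  | of {w w' : Word A} : Move R w w' → MoveC R w w'
  | cyc {w w' : Word A} : Word.IsCyclicConj w w' → MoveC R w w'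

/-- Moves (i)–(v) on finite sequences of words: one of the moves (i)–(iv) applied to
one word of the sequence, or fragmentation of one word `u ++ v` into `u` and `v`. -/
inductive MoveF {A : Type*} (R : Set (Word A)) : List (Word A) → List (Word A) → Prop
  | of (l₁ l₂ : List (Word A)) {w w' : Word A} :
      MoveC R w w' → MoveF R (l₁ ++ w :: l₂) (l₁ ++ w' :: l₂)
  | frag (l₁ l₂ : List (Word A)) (u v : Word A) :
      MoveF R (l₁ ++ (u ++ v) :: l₂) (l₁ ++ u :: v :: l₂)

/-- A word is null-homotopic over the presentation with relator set `R` if it represents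
the identity of the presented group, i.e. lies in the normal closure of the relators. -/
def NullHomotopic {A : Type*} (R : Set (Word A)) (w : Word A) : Prop :=
  FreeGroup.mk w ∈ Subgroup.normalClosure (FreeGroup.mk '' R)

/-- `FLle R w L`: the word `w` can be converted to the empty word by moves (i)–(iii)
with every intermediate word of length at most `L`. -/
def FLle {A : Type*} (R : Set (Word A)) (w : Word A) (L : ℕ) : Prop :=
  ∃ (m : ℕ) (f : ℕ → Word A), f 0 = w ∧ f m = [] ∧
    (∀ i < m, Move R (f i) (f (i + 1))) ∧ ∀ i ≤ m, (f i).length ≤ L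

/-- `FFLle R w L`: the word `w` can be converted to the empty word by moves (i)–(iv)
with every intermediate word of length at most `L`. -/
def FFLle {A : Type*} (R : Set (Word A)) (w : Word A) (L : ℕ) : Prop :=
  ∃ (m : ℕ) (f : ℕ → Word A), f 0 = w ∧ f m = [] ∧
    (∀ i < m, MoveC R (f i) (f (i + 1))) ∧ ∀ i ≤ m, (f i).length ≤ L

/-- The total length of a finite sequence of words. -/
def totalLength {A : Type*} (l : List (Word A)) : ℕ := (l.map List.length).sum

/-- `FFFLle R w L`: the length-one sequence `(w)` can be converted to a sequence of empty
words by moves (i)–(v) with every intermediate sequence of total length at most `L`. -/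
def FFFLle {A : Type*} (R : Set (Word A)) (w : Word A) (L : ℕ) : Prop :=
  ∃ (m : ℕ) (f : ℕ → List (Word A)), f 0 = [w] ∧ (∀ u ∈ f m, u = ([] : Word A)) ∧
    (∀ i < m, MoveF R (f i) (f (i + 1))) ∧ ∀ i ≤ m, totalLength (f i) ≤ L

/-- An element `x` of the free group is a conjugate of a relator of `R` or of an inverse
of a relator. -/
def IsConjRelator {A : Type*} (R : Set (Word A)) (x : FreeGroup A) : Prop :=
  ∃ c ρ : FreeGroup A, (ρ ∈ FreeGroup.mk '' R ∨ ρ⁻¹ ∈ FreeGroup.mk '' R) ∧ x = c * ρ * c⁻¹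

/-- `AreaLe R g N`: in the free group, `g` is a product of at most `N` conjugates
of elements of `R ∪ R⁻¹`. -/
def AreaLe {A : Type*} (R : Set (Word A)) (g : FreeGroup A) (N : ℕ) : Prop :=
  ∃ l : List (FreeGroup A), l.length ≤ N ∧ (∀ x ∈ l, IsConjRelator R x) ∧ l.prod = g

/-- The number of occurrences in `w` of the letter `x` or its inverse. -/
def countLtr {A : Type*} [DecidableEq A] (x : A) (w : Word A) : ℕ :=
  (w.filter fun p => p.1 = x).length

/-- The filling length `FL(w)` of a null-homotopic word. -/
noncomputable def FLw {A : Type*} (R : Set (Word A)) (w : Word A) : ℕ :=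
  sInf {L | FLle R w L}

/-- The free filling length `FFL(w)` of a null-homotopic word. -/
noncomputable def FFLw {A : Type*} (R : Set (Word A)) (w : Word A) : ℕ :=
  sInf {L | FFLle R w L}

/-- The fragmenting free filling length `FFFL(w)` of a null-homotopic word. -/
noncomputable def FFFLw {A : Type*} (R : Set (Word A)) (w : Word A) : ℕ :=
  sInf {L | FFFLle R w L}

/-- The filling length function `FL : ℕ → ℕ` of the presentation with relators `R`. -/
noncomputable def FLfn {A : Type*} (R : Set (Word A)) (n : ℕ) : ℕ :=
  sSup (FLw R '' {w | NullHomotopic R w ∧ w.length ≤ n})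

/-- The free filling length function `FFL : ℕ → ℕ`. -/
noncomputable def FFLfn {A : Type*} (R : Set (Word A)) (n : ℕ) : ℕ :=
  sSup (FFLw R '' {w | NullHomotopic R w ∧ w.length ≤ n})

/-- The fragmenting free filling length function `FFFL : ℕ → ℕ`. -/
noncomputable def FFFLfn {A : Type*} (R : Set (Word A)) (n : ℕ) : ℕ :=
  sSup (FFFLw R '' {w | NullHomotopic R w ∧ w.length ≤ n})

/-! The presentation `Q = ⟨a, b, r, s, t | a^b a⁻², [t,a], [r,at], [r,s], [s,t]⟩`. -/

/-- The five generators of the presentation `Q`. -/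
inductive QGen | a | b | r | s | t
deriving DecidableEq

/-- The five relators of `Q`: `b⁻¹aba⁻¹a⁻¹`, `t⁻¹a⁻¹ta`, `r⁻¹t⁻¹a⁻¹rat`,
`r⁻¹s⁻¹rs`, `s⁻¹t⁻¹st`. -/
def QRels : Set (Word QGen) :=
  { [(QGen.b, false), (QGen.a, true), (QGen.b, true), (QGen.a, false), (QGen.a, false)],
    [(QGen.t, false), (QGen.a, false), (QGen.t, true), (QGen.a, true)],
    [(QGen.r, false), (QGen.t, false), (QGen.a, false), (QGen.r, true), (QGen.a, true),
      (QGen.t, true)],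
    [(QGen.r, false), (QGen.s, false), (QGen.r, true), (QGen.s, true)],
    [(QGen.s, false), (QGen.t, false), (QGen.s, true), (QGen.t, true)] }

/-- The word `bⁿ`. -/
def bpow (n : ℕ) : Word QGen := List.replicate n (QGen.b, true)

/-- The word `b⁻ⁿ`. -/
def bpowInv (n : ℕ) : Word QGen := List.replicate n (QGen.b, false)

/-- The word `a^{-bⁿ} = b⁻ⁿ a⁻¹ bⁿ`. -/
def aConjNeg (n : ℕ) : Word QGen := bpowInv n ++ [(QGen.a, false)] ++ bpow n

/-- The word `a^{bⁿ} = b⁻ⁿ a bⁿ`. -/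
def aConjPos (n : ℕ) : Word QGen := bpowInv n ++ [(QGen.a, true)] ++ bpow n

/-- The word `a^{-bⁿ} r a^{bⁿ}`. -/
def gword (n : ℕ) : Word QGen := aConjNeg n ++ [(QGen.r, true)] ++ aConjPos n

/-- The word `w_n = [s, a^{-bⁿ} r a^{bⁿ}] = s⁻¹ (b⁻ⁿa⁻¹bⁿ r b⁻ⁿabⁿ)⁻¹ s (b⁻ⁿa⁻¹bⁿ r b⁻ⁿabⁿ)`. -/
def wn (n : ℕ) : Word QGen :=
  [(QGen.s, false)] ++ Word.inv (gword n) ++ [(QGen.s, true)] ++ gword n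

/-- The word `a^{-bⁿ} r a^{bⁿ} r a^{bⁿ} r⁻¹ a^{-bⁿ}`. -/
def g'word (n : ℕ) : Word QGen :=
  aConjNeg n ++ [(QGen.r, true)] ++ aConjPos n ++ [(QGen.r, true)] ++ aConjPos n ++
    [(QGen.r, false)] ++ aConjNeg n

/-- The word `w'_n = [s, a^{-bⁿ} r a^{bⁿ} r a^{bⁿ} r⁻¹ a^{-bⁿ}]`. -/
def w'n (n : ℕ) : Word QGen :=
  [(QGen.s, false)] ++ Word.inv (g'word n) ++ [(QGen.s, true)] ++ g'word n

/-- The three generators of `Q₀ = ⟨a, b, t | a^b a⁻², [a,t]⟩`. -/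
inductive Q0Gen | a | b | t
deriving DecidableEq

/-- The relators `b⁻¹aba⁻¹a⁻¹` and `a⁻¹t⁻¹at` of `Q₀`. -/
def Q0Rels : Set (Word Q0Gen) :=
  { [(Q0Gen.b, false), (Q0Gen.a, true), (Q0Gen.b, true), (Q0Gen.a, false), (Q0Gen.a, false)],
    [(Q0Gen.a, false), (Q0Gen.t, false), (Q0Gen.a, true), (Q0Gen.t, true)] }

namespace Word

variable {A : Type*}

@[simp] theorem inv_append (u v : Word A) : inv (u ++ v) = inv v ++ inv u := by
  simp [inv]

@[simp] theorem inv_inv (u : Word A) : inv (inv u) = u := by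
  simp [inv, Function.comp_def]

end Word

theorem Move.symm {A : Type*} {R : Set (Word A)} {u v : Word A} (h : Move R u v) :
    Move R v u := by
  cases h with
  | freeReduce u v x b => exact .freeExpand u v x b
  | freeExpand u v x b => exact .freeReduce u v x b
  | relator p q u v z hz hR =>
    obtain ⟨s, t, h₁, rfl⟩ := hz
    refine .relator p q v u (Word.inv (t ++ s)) ⟨Word.inv t, Word.inv s, ?_, by simp⟩ ?_
    · rw [← Word.inv_append, ← h₁]; simp
    · simpa [or_comm] using hR

theorem Move.append {A : Type*} {R : Set (Word A)} {u v : Word A} (h : Move R u v)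
    (p q : Word A) : Move R (p ++ u ++ q) (p ++ v ++ q) := by
  cases h with
  | freeReduce u v x b => simpa using Move.freeReduce (R := R) (p ++ u) (v ++ q) x b
  | freeExpand u v x b => simpa using Move.freeExpand (R := R) (p ++ u) (v ++ q) x b
  | relator p' q' u v z hz hR =>
    simpa using Move.relator (R := R) (p ++ p') (q' ++ q) u v z hz hR

/-- `Conn R L u v`: the word `u` can be converted to `v` by moves (i)–(iii) through words
of length at most `L`. -/
def Conn {A : Type*} (R : Set (Word A)) (L : ℕ) : Word A → Word A → Prop :=
  Relation.ReflTransGen fun u v => Move R u v ∧ u.length ≤ L ∧ v.length ≤ L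

namespace Conn

variable {A : Type*} {R : Set (Word A)} {L L' : ℕ} {u v w : Word A}

theorem refl (u : Word A) : Conn R L u u := Relation.ReflTransGen.refl

theorem trans (h : Conn R L u v) (h' : Conn R L v w) : Conn R L u w :=
  Relation.ReflTransGen.trans h h'

theorem symm (h : Conn R L u v) : Conn R L v u :=
  haveI : Std.Symm fun u v : Word A => Move R u v ∧ u.length ≤ L ∧ v.length ≤ L :=
    ⟨fun _ _ h => ⟨h.1.symm, h.2.2, h.2.1⟩⟩
  Relation.ReflTransGen.stdSymm.symm _ _ h

theorem of_move (h : Move R u v) (hu : u.length ≤ L) (hv : v.length ≤ L) : Conn R L u v :=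
  Relation.ReflTransGen.single ⟨h, hu, hv⟩

theorem append (h : Conn R L u v) (p q : Word A) (hL : p.length + L + q.length ≤ L') :
    Conn R L' (p ++ u ++ q) (p ++ v ++ q) := by
  refine Relation.ReflTransGen.lift (fun u => p ++ u ++ q)
    (fun u v h => ⟨h.1.append p q, ?_⟩) _ _ h
  simp only [List.length_append]
  omega

theorem mono (h : Conn R L u v) (hL : L ≤ L') : Conn R L' u v := by
  simpa using h.append [] [] (by simpa using hL)

theorem fLle (h : Conn R L w []) (hw : w.length ≤ L) : FLle R w L := by
  induction h using Relation.ReflTransGen.head_induction_on with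
  | refl => exact ⟨0, fun _ => [], rfl, rfl, by simp, by simp⟩
  | head h _ ih =>
    obtain ⟨m, f, h0, hm, hmove, hlen⟩ := ih h.2.2
    refine ⟨m + 1, fun i => Nat.casesOn i _ f, by rfl, hm, ?_, ?_⟩
    · rintro (_ | i) hi
      · simpa [h0] using h.1
      · exact hmove i (by omega)
    · rintro (_ | i) hi
      · exact hw
      · exact hlen i (by omega)

theorem cancel (x : A) (b : Bool) : Conn R 2 [(x, b), (x, !b)] [] :=
  of_move (.freeReduce [] [] x b) (by simp) (by simp)

end Conn

namespace Q0

open Q0Gen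

theorem conn_a_b : Conn Q0Rels 3 [(a, true), (b, true)] [(b, true), (a, true), (a, true)] := by
  refine .of_move (.relator [] [] [(a, true), (b, true)] [(b, true), (a, true), (a, true)]
    [(b, false), (a, true), (b, true), (a, false), (a, false)]
    ⟨[(a, true), (b, true), (a, false), (a, false)], [(b, false)], rfl, rfl⟩ ?_)
    (by simp) (by simp)
  simp [Q0Rels]

theorem conn_a_a_binv :
    Conn Q0Rels 3 [(a, true), (a, true), (b, false)] [(b, false), (a, true)] := by
  refine .of_move (.relator [] [] [(a, true), (a, true), (b, false)] [(b, false), (a, true)]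
    [(a, true), (a, true), (b, false), (a, false), (b, true)] ⟨[], _, rfl, rfl⟩ ?_)
    (by simp) (by simp)
  simp [Q0Rels, Word.inv]

theorem conn_a_t (s : Bool) : Conn Q0Rels 3 [(a, true), (t, s)] [(t, s), (a, true)] := by
  cases s
  · refine .of_move (.relator [] [] [(a, true), (t, false)] [(t, false), (a, true)]
      [(t, false), (a, false), (t, true), (a, true)]
      ⟨[(a, true)], _, rfl, rfl⟩ ?_) (by simp) (by simp)
    simp [Q0Rels, Word.inv]
  · refine .of_move (.relator [] [] [(a, true), (t, true)] [(t, true), (a, true)]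
      [(a, false), (t, false), (a, true), (t, true)]
      ⟨[(a, true), (t, true)], _, rfl, rfl⟩ ?_) (by simp) (by simp)
    simp [Q0Rels]

/-- The word `aᵐ`. -/
def apow (m : ℤ) : Word Q0Gen := List.replicate m.natAbs (a, decide (0 ≤ m))

/-- A word of length `O(N)` representing `aᵐ` for `|m| ≤ 2 ^ N`, with the least significant
binary digit of `m` on the left. -/
def lword : ℕ → ℤ → Word Q0Gen
  | 0, m => apow m
  | N + 1, m => apow (m % 2) ++ ((b, false) :: lword N (m / 2) ++ [(b, true)])

/-- A word of length `O(N)` representing `aᵐ` for `|m| ≤ 2 ^ N`, with the least significant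
binary digit of `m` on the right. -/
def rword : ℕ → ℤ → Word Q0Gen
  | 0, m => apow m
  | N + 1, m => ((b, false) :: rword N (m / 2) ++ [(b, true)]) ++ apow (m % 2)

theorem length_lword_le (N : ℕ) (m : ℤ) (h₁ : -2 ^ N ≤ m) (h₂ : m ≤ 2 ^ N) :
    (lword N m).length ≤ 3 * N + 1 := by
  induction N generalizing m with
  | zero => simp [lword, apow]; omega
  | succ N ih =>
    have := ih (m / 2) (by omega) (by omega)
    simp [lword, apow]; omega

theorem length_rword_le (N : ℕ) (m : ℤ) (h₁ : -2 ^ N ≤ m) (h₂ : m ≤ 2 ^ N) :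
    (rword N m).length ≤ 3 * N + 1 := by
  induction N generalizing m with
  | zero => simp [rword, apow]; omega
  | succ N ih =>
    have := ih (m / 2) (by omega) (by omega)
    simp [rword, apow]; omega

theorem conn_lword_zero (N : ℕ) : Conn Q0Rels (3 * N + 3) (lword N 0) [] := by
  induction N with
  | zero => exact .refl _
  | succ N ih =>
    have h := ih.append (L' := 3 * (N + 1) + 3) [(b, false)] [(b, true)] (by simp; omega)
    exact h.trans ((Conn.cancel b false).mono (by omega))

theorem conn_rword_zero (N : ℕ) : Conn Q0Rels (3 * N + 3) (rword N 0) [] := by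
  induction N with
  | zero => exact .refl _
  | succ N ih =>
    have h := ih.append (L' := 3 * (N + 1) + 3) [(b, false)] [(b, true)] (by simp; omega)
    simp only [rword, apow, Int.zero_emod, Int.zero_ediv, Int.natAbs_zero, List.replicate_zero,
      List.append_nil]
    exact h.trans ((Conn.cancel b false).mono (by omega))

theorem conn_a_lword (N : ℕ) (m : ℤ) (h₁ : -2 ^ N ≤ m) (h₂ : m + 1 ≤ 2 ^ N) :
    Conn Q0Rels (3 * N + 4) ((a, true) :: lword N m) (lword N (m + 1)) := by
  induction N generalizing m with
  | zero =>
    obtain rfl | rfl : m = -1 ∨ m = 0 := by simp at h₁ h₂; omega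
    · exact (Conn.cancel a true).mono (by omega)
    · exact .refl _
  | succ N ih =>
    obtain ⟨q, rfl | rfl⟩ : ∃ q, m = 2 * q ∨ m = 2 * q + 1 := ⟨m / 2, by omega⟩
    · have e₁ : (2 * q) / 2 = q := by omega
      have e₂ : (2 * q + 1) / 2 = q := by omega
      have e₃ : (2 * q + 1) % 2 = 1 := by omega
      have e₄ : (2 * q) % 2 = 0 := by omega
      simpa [lword, e₁, e₂, e₃, e₄, apow] using Conn.refl _
    · have e₁ : (2 * q + 1 + 1) / 2 = q + 1 := by omega
      have e₂ : (2 * q + 1) / 2 = q := by omega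
      have e₃ : (2 * q + 1) % 2 = 1 := by omega
      have e₄ : (2 * q + 1 + 1) % 2 = 0 := by omega
      have hl := length_lword_le N q (by omega) (by omega)
      have h := conn_a_a_binv.append (L' := 3 * (N + 1) + 4) [] (lword N q ++ [(b, true)])
        (by simp; omega)
      have h' := (ih q (by omega) (by omega)).append (L' := 3 * (N + 1) + 4)
        [(b, false)] [(b, true)] (by simp; omega)
      simpa [lword, e₁, e₂, e₃, e₄, apow] using
        Conn.trans (by simpa using h) (by simpa using h')

theorem conn_rword_a (N : ℕ) (m : ℤ) (h₁ : -2 ^ N ≤ m) (h₂ : m + 1 ≤ 2 ^ N) :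
    Conn Q0Rels (3 * N + 4) (rword N m ++ [(a, true)]) (rword N (m + 1)) := by
  induction N generalizing m with
  | zero =>
    obtain rfl | rfl : m = -1 ∨ m = 0 := by simp at h₁ h₂; omega
    · exact (Conn.cancel a false).mono (by omega)
    · exact .refl _
  | succ N ih =>
    obtain ⟨q, rfl | rfl⟩ : ∃ q, m = 2 * q ∨ m = 2 * q + 1 := ⟨m / 2, by omega⟩
    · have e₁ : (2 * q) / 2 = q := by omega
      have e₂ : (2 * q + 1) / 2 = q := by omega
      have e₃ : (2 * q + 1) % 2 = 1 := by omega
      have e₄ : (2 * q) % 2 = 0 := by omega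
      simpa [rword, e₁, e₂, e₃, e₄, apow] using Conn.refl _
    · have e₁ : (2 * q + 1 + 1) / 2 = q + 1 := by omega
      have e₂ : (2 * q + 1) / 2 = q := by omega
      have e₃ : (2 * q + 1) % 2 = 1 := by omega
      have e₄ : (2 * q + 1 + 1) % 2 = 0 := by omega
      have hl := length_rword_le N q (by omega) (by omega)
      have h := conn_a_b.symm.append (L' := 3 * (N + 1) + 4) ((b, false) :: rword N q) []
        (by simp; omega)
      have h' := (ih q (by omega) (by omega)).append (L' := 3 * (N + 1) + 4)
        [(b, false)] [(b, true)] (by simp; omega)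
      simpa [rword, e₁, e₂, e₃, e₄, apow] using
        Conn.trans (by simpa using h) (by simpa using h')

theorem conn_apow_lword (N i : ℕ) (m : ℤ) (h₁ : -2 ^ N ≤ m) (h₂ : m + i ≤ 2 ^ N) :
    Conn Q0Rels (3 * N + 4 + i) (List.replicate i (a, true) ++ lword N m) (lword N (m + i)) := by
  induction i generalizing m with
  | zero => simpa using Conn.refl _
  | succ i ih =>
    push_cast at h₂
    have h := (conn_a_lword N m h₁ (by omega)).append (L' := 3 * N + 4 + (i + 1))
      (List.replicate i (a, true)) [] (by simp; omega)
    have h' := (ih (m + 1) (by omega) (by omega)).mono (L' := 3 * N + 4 + (i + 1)) (by omega)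
    have e : m + 1 + (i : ℤ) = m + ((i + 1 : ℕ) : ℤ) := by push_cast; ring
    rw [e] at h'
    rw [List.replicate_succ']
    exact Conn.trans (by simpa using h) h'

theorem conn_rword_apow (N i : ℕ) (m : ℤ) (h₁ : -2 ^ N ≤ m) (h₂ : m + i ≤ 2 ^ N) :
    Conn Q0Rels (3 * N + 4 + i) (rword N m ++ List.replicate i (a, true)) (rword N (m + i)) := by
  induction i generalizing m with
  | zero => simpa using Conn.refl _
  | succ i ih =>
    push_cast at h₂
    have h := (conn_rword_a N m h₁ (by omega)).append (L' := 3 * N + 4 + (i + 1))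
      [] (List.replicate i (a, true)) (by simp)
    have h' := (ih (m + 1) (by omega) (by omega)).mono (L' := 3 * N + 4 + (i + 1)) (by omega)
    have e : m + 1 + (i : ℤ) = m + ((i + 1 : ℕ) : ℤ) := by push_cast; ring
    rw [e] at h'
    rw [List.replicate_succ]
    exact Conn.trans (by simpa using h) h'

section transfer

variable {N i j : ℕ} {X : Word Q0Gen}

theorem conn_transfer_step (hi : i ≤ 2) (hj : j ≤ 2) (hX : X.length ≤ 1)
    (h : Conn Q0Rels 3 (List.replicate i (a, true) ++ X) (X ++ List.replicate j (a, true)))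
    (k l : ℤ) (hk₁ : -2 ^ N ≤ k) (hk₂ : k + i ≤ 2 ^ N) (hl₁ : -2 ^ N ≤ l) (hl₂ : l + j ≤ 2 ^ N) :
    Conn Q0Rels (6 * N + 20) (rword N (k + i) ++ X ++ lword N l)
      (rword N k ++ X ++ lword N (l + j)) := by
  have hr := length_rword_le N k (by omega) (by omega)
  have hl := length_lword_le N l (by omega) (by omega)
  have c₁ := (conn_rword_apow N i k hk₁ hk₂).symm.append (L' := 6 * N + 20) [] (X ++ lword N l)
    (by simp; omega)
  have c₂ := h.append (L' := 6 * N + 20) (rword N k) (lword N l) (by omega)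
  have c₃ := (conn_apow_lword N j l hl₁ hl₂).append (L' := 6 * N + 20) (rword N k ++ X) []
    (by simp; omega)
  simp only [List.append_assoc, List.nil_append, List.append_nil] at c₁ c₂ c₃ ⊢
  exact c₁.trans (c₂.trans c₃)

theorem conn_transfer (hi : i ≤ 2) (hj : j ≤ 2) (hX : X.length ≤ 1)
    (h : Conn Q0Rels 3 (List.replicate i (a, true) ++ X) (X ++ List.replicate j (a, true)))
    (k : ℤ) (hk₁ : -2 ^ N ≤ i * k) (hk₂ : i * k ≤ 2 ^ N) (hl₁ : -2 ^ N ≤ j * k)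
    (hl₂ : j * k ≤ 2 ^ N) :
    Conn Q0Rels (6 * N + 20) (rword N (i * k) ++ X) (X ++ lword N (j * k)) := by
  have main : Conn Q0Rels (6 * N + 20) (rword N (i * k) ++ X ++ lword N 0)
      (rword N 0 ++ X ++ lword N (j * k)) := by
    obtain ⟨n, rfl | rfl⟩ := k.eq_nat_or_neg
    · have aux : ∀ p ≤ n, Conn Q0Rels (6 * N + 20)
          (rword N (i * (p : ℤ)) ++ X ++ lword N (j * ((n : ℤ) - p)))
          (rword N 0 ++ X ++ lword N (j * (n : ℤ))) := by
        intro p hp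
        induction p with
        | zero => simpa using Conn.refl _
        | succ p ih =>
          have b₁ : (i : ℤ) * p + i ≤ i * n := by
            have : (i : ℤ) * (p + 1) ≤ i * n := by gcongr; exact_mod_cast hp
            linarith
          have b₂ : (0 : ℤ) ≤ i * p := by positivity
          have b₃ : (j : ℤ) * (p + 1) ≤ j * n := by gcongr; exact_mod_cast hp
          have b₄ : (0 : ℤ) ≤ j * p := by positivity
          have s := conn_transfer_step (N := N) hi hj hX h (i * p) (j * ((n : ℤ) - (p + 1)))
            (by linarith) (by linarith) (by linarith) (by linarith)
          have e₁ : (i : ℤ) * p + i = i * ((p + 1 : ℕ) : ℤ) := by push_cast; ring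
          have e₂ : (j : ℤ) * ((n : ℤ) - (p + 1)) + j = j * ((n : ℤ) - p) := by ring
          rw [e₁, e₂] at s
          simpa using s.trans (ih (by omega))
      simpa using aux n le_rfl
    · have aux : ∀ p ≤ n, Conn Q0Rels (6 * N + 20)
          (rword N (i * (-p : ℤ)) ++ X ++ lword N (j * ((p : ℤ) - n)))
          (rword N 0 ++ X ++ lword N (j * (-n : ℤ))) := by
        intro p hp
        induction p with
        | zero => simpa using Conn.refl _
        | succ p ih =>
          have b₁ : (i : ℤ) * (p + 1) ≤ i * n := by gcongr; exact_mod_cast hp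
          have b₂ : (0 : ℤ) ≤ i * p := by positivity
          have b₃ : (j : ℤ) * (p + 1) ≤ j * n := by gcongr; exact_mod_cast hp
          have b₄ : (0 : ℤ) ≤ j * p := by positivity
          have s := conn_transfer_step (N := N) hi hj hX h (i * (-(p + 1 : ℤ))) (j * ((p : ℤ) - n))
            (by linarith) (by linarith) (by linarith) (by linarith)
          have e₁ : (i : ℤ) * (-(p + 1 : ℤ)) + i = i * (-p : ℤ) := by ring
          have e₂ : (j : ℤ) * ((p : ℤ) - n) + j = j * (((p + 1 : ℕ) : ℤ) - n) := by push_cast; ring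
          rw [e₁, e₂] at s
          simpa using s.symm.trans (ih (by omega))
      simpa using aux n le_rfl
  have hr := length_rword_le N (i * k) hk₁ hk₂
  have hl := length_lword_le N (j * k) hl₁ hl₂
  have c₁ := (conn_lword_zero N).append (L' := 6 * N + 20) (rword N (i * k) ++ X) []
    (by simp; omega)
  have c₂ := (conn_rword_zero N).append (L' := 6 * N + 20) [] (X ++ lword N (j * k))
    (by simp; omega)
  simp only [List.append_assoc, List.nil_append, List.append_nil] at c₁ c₂ main ⊢
  exact c₁.symm.trans (main.trans c₂)

end transfer

theorem conn_rword_lword (N : ℕ) (m : ℤ) (h₁ : -2 ^ N ≤ m) (h₂ : m ≤ 2 ^ N) :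
    Conn Q0Rels (6 * N + 20) (rword N m) (lword N m) := by
  simpa using conn_transfer (N := N) (i := 1) (j := 1) (X := []) (by simp) (by simp) (by simp)
    (.refl _) m (by simpa) (by simpa) (by simpa) (by simpa)

theorem conn_lword_append {N : ℕ} {m : ℤ} {x : Q0Gen × Bool} {v : Word Q0Gen}
    (h₁ : -2 ^ N ≤ m) (h₂ : m ≤ 2 ^ N) (h : Conn Q0Rels (6 * N + 20) (rword N m ++ [x]) v) :
    Conn Q0Rels (6 * N + 21) (lword N m ++ [x]) v :=
  ((conn_rword_lword N m h₁ h₂).symm.append [] [x] (by simp)).trans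
    (h.mono (by omega))

theorem conn_lword_a (N : ℕ) (m : ℤ) (h₁ : -2 ^ N ≤ m) (h₂ : m + 1 ≤ 2 ^ N) :
    Conn Q0Rels (6 * N + 21) (lword N m ++ [(a, true)]) (lword N (m + 1)) :=
  conn_lword_append h₁ (by omega) <|
    ((conn_rword_a N m h₁ h₂).mono (by omega)).trans
      (conn_rword_lword N (m + 1) (by omega) h₂)

theorem conn_lword_ainv (N : ℕ) (m : ℤ) (h₁ : -2 ^ N ≤ m - 1) (h₂ : m ≤ 2 ^ N) :
    Conn Q0Rels (6 * N + 21) (lword N m ++ [(a, false)]) (lword N (m - 1)) := by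
  have hr := length_rword_le N (m - 1) h₁ (by omega)
  have c₁ := (conn_rword_a N (m - 1) h₁ (by omega)).symm.append (L' := 6 * N + 20) []
    [(a, false)] (by simp; omega)
  have c₂ := (Conn.cancel (R := Q0Rels) a true).append (L' := 6 * N + 20) (rword N (m - 1)) []
    (by simp; omega)
  simp only [List.append_assoc, List.nil_append, List.append_nil, sub_add_cancel] at c₁ c₂
  exact conn_lword_append (by omega) h₂ <|
    c₁.trans (c₂.trans (conn_rword_lword N (m - 1) h₁ (by omega)))

theorem conn_lword_t (N : ℕ) (m : ℤ) (s : Bool) (h₁ : -2 ^ N ≤ m) (h₂ : m ≤ 2 ^ N) :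
    Conn Q0Rels (6 * N + 21) (lword N m ++ [(t, s)]) ((t, s) :: lword N m) :=
  conn_lword_append h₁ h₂ <| by
    simpa using conn_transfer (N := N) (i := 1) (j := 1) (X := [(t, s)]) (by simp) (by simp)
      (by simp) (conn_a_t s) m (by simpa) (by simpa) (by simpa) (by simpa)

theorem conn_lword_b (N : ℕ) (m : ℤ) (h₁ : -2 ^ N ≤ 2 * m) (h₂ : 2 * m ≤ 2 ^ N) :
    Conn Q0Rels (6 * N + 21) (lword N m ++ [(b, true)]) ((b, true) :: lword N (2 * m)) :=
  conn_lword_append (by omega) (by omega) <| by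
    simpa using conn_transfer (N := N) (i := 1) (j := 2) (X := [(b, true)]) (by simp) (by simp)
      (by simp) conn_a_b m (by push_cast; omega) (by push_cast; omega) (by simpa) (by simpa)

theorem conn_lword_binv (N : ℕ) (m : ℤ) (h₁ : -2 ^ N < m) (h₂ : m ≤ 2 ^ N) :
    Conn Q0Rels (6 * N + 22) (lword N m ++ [(b, false)])
      (apow (m % 2) ++ (b, false) :: lword N (m / 2)) := by
  have even : ∀ q : ℤ, -2 ^ N ≤ 2 * q → 2 * q ≤ 2 ^ N → Conn Q0Rels (6 * N + 21)
      (lword N (2 * q) ++ [(b, false)]) ((b, false) :: lword N q) := fun q h₁ h₂ =>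
    conn_lword_append (by omega) (by omega) <| by
      simpa using conn_transfer (N := N) (i := 2) (j := 1) (X := [(b, false)]) (by simp) (by simp)
        (by simp) conn_a_a_binv q (by simpa) (by simpa) (by push_cast; omega) (by push_cast; omega)
  obtain ⟨q, rfl | rfl⟩ : ∃ q, m = 2 * q ∨ m = 2 * q + 1 := ⟨m / 2, by omega⟩
  · have e₁ : (2 * q) / 2 = q := by omega
    have e₂ : (2 * q) % 2 = 0 := by omega
    simpa [e₁, e₂, apow] using (even q h₁.le h₂).mono (by omega)
  · have e₁ : (2 * q + 1) / 2 = q := by omega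
    have e₂ : (2 * q + 1) % 2 = 1 := by omega
    have hb : -2 ^ N ≤ 2 * q := by
      cases N <;> omega
    have c₁ := (conn_a_lword N (2 * q) hb h₂).symm.append (L' := 6 * N + 22) [] [(b, false)]
      (by simp; omega)
    have c₂ := (even q hb (by omega)).append (L' := 6 * N + 22) [(a, true)] [] (by simp; omega)
    simp only [List.nil_append, List.append_nil, List.cons_append] at c₁ c₂
    simpa [e₁, e₂, apow] using c₁.trans c₂

/-- The letters `t^±¹`, `b`, `b⁻¹` and `ab⁻¹` of normal forms in the group presented by `Q₀`:
`binv ε` stands for `a^ε b⁻¹`. -/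
inductive NLetter
  | t (s : Bool)
  | b
  | binv (ε : Bool)

/-- The condition for the letter `x` to follow the letter `y` in a normal form. -/
def NLetter.Follows : NLetter → NLetter → Prop
  | .t s, .t s' => s' = s
  | .b, .binv _ => False
  | .binv false, .b => False
  | _, _ => True

/-- The word represented by a letter of a normal form. -/
def NLetter.word : NLetter → Word Q0Gen
  | .t s => [(Q0Gen.t, s)]
  | .b => [(Q0Gen.b, true)]
  | .binv ε => apow ε.toInt ++ [(Q0Gen.b, false)]

/-- The word represented by a stack of letters, the last letter of the word being the head of
the stack. -/
def stackWord : List NLetter → Word Q0Gen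
  | [] => []
  | x :: st => stackWord st ++ x.word

/-- Multiply the normal form `st · aᵐ` on the right by a letter. -/
def step : Q0Gen × Bool → List NLetter × ℤ → List NLetter × ℤ
  | (.a, true), (st, m) => (st, m + 1)
  | (.a, false), (st, m) => (st, m - 1)
  | (.t, s), (.t s' :: st, m) => if s' = s then (.t s :: .t s' :: st, m) else (st, m)
  | (.t, s), (st, m) => (.t s :: st, m)
  | (.b, true), (.binv ε :: st, m) => (st, 2 * m + ε.toInt)
  | (.b, true), (st, m) => (.b :: st, 2 * m)
  | (.b, false), (.b :: st, m) =>
    if m % 2 = 0 then (st, m / 2) else (.binv true :: .b :: st, m / 2)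
  | (.b, false), (st, m) => (.binv (decide (m % 2 = 1)) :: st, m / 2)

/-- Normal forms `x₁ ⋯ xₖ aᵐ` in the group presented by `Q₀`. -/
abbrev NForm : Type := {s : List NLetter × ℤ // s.1.IsChain NLetter.Follows}

theorem isChain_step (x : Q0Gen × Bool) (s : List NLetter × ℤ)
    (h : s.1.IsChain NLetter.Follows) : (step x s).1.IsChain NLetter.Follows := by
  obtain ⟨st, m⟩ := s
  obtain ⟨_ | _ | _, _ | _⟩ := x <;> rcases st with _ | ⟨_ | _ | _, _ | ⟨y, st⟩⟩ <;>
    simp only [step] <;> (try split_ifs) <;>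
    simp_all [List.isChain_cons_cons, NLetter.Follows]

theorem step_step (x : Q0Gen) (c : Bool) (s : List NLetter × ℤ)
    (h : s.1.IsChain NLetter.Follows) : step (x, !c) (step (x, c) s) = s := by
  obtain ⟨st, m⟩ := s
  obtain _ | _ | _ := x
  · cases c <;> simp [step]
  · cases c
    · have hmod : 2 * (m / 2) + (decide (m % 2 = 1)).toInt = m := by
        rcases Int.emod_two_eq_zero_or_one m with h | h <;> simp [h] <;> omega
      rcases st with _ | ⟨_ | _ | ε, st⟩
      · simp [step, hmod]
      · simp [step, hmod]
      · by_cases hm : m % 2 = 0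
        · have h₂ : 2 * (m / 2) = m := by omega
          rcases st with _ | ⟨_ | _ | _, st⟩
          · simp [step, hm, h₂]
          · simp [step, hm, h₂]
          · simp [step, hm, h₂]
          · simp [List.isChain_cons_cons, NLetter.Follows] at h
        · have h₂ : 2 * (m / 2) + 1 = m := by omega
          simp [step, hm, h₂]
      · simp [step, hmod]
    · rcases st with _ | ⟨_ | _ | ε, st⟩
      · simp [step]
      · simp [step]
      · simp [step]
      · cases ε
        · rcases st with _ | ⟨_ | _ | _, st⟩
          · simp [step]
          · simp [step]
          · simp [List.isChain_cons_cons, NLetter.Follows] at h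
          · simp [step]
        · have h₁ : (2 * m + 1) % 2 = 1 := by omega
          have h₂ : (2 * m + 1) / 2 = m := by omega
          rcases st with _ | ⟨_ | _ | _, st⟩ <;> simp [step, h₁, h₂]
  · rcases st with _ | ⟨s | _ | _, st⟩
    · cases c <;> simp [step]
    · by_cases hs : s = c
      · subst hs
        cases s <;> simp [step]
      · obtain rfl : s = !c := by cases s <;> cases c <;> simp_all
        rcases st with _ | ⟨s' | _ | _, st⟩
        · cases c <;> simp [step]
        · obtain rfl : s' = !c := h.rel
          cases c <;> simp [step]
        · cases c <;> simp [step]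
        · cases c <;> simp [step]
    · cases c <;> simp [step]
    · cases c <;> simp [step]

/-- Right multiplication of a normal form by a letter. -/
def NForm.step (x : Q0Gen × Bool) (s : NForm) : NForm :=
  ⟨Q0.step x s.1, isChain_step x s.1 s.2⟩

/-- Right multiplication by the inverse of a generator, as a permutation of the set of
normal forms. -/
def NForm.perm (x : Q0Gen) : Equiv.Perm NForm where
  toFun := NForm.step (x, false)
  invFun := NForm.step (x, true)
  left_inv s := Subtype.ext (step_step x false s.1 s.2)
  right_inv s := Subtype.ext (step_step x true s.1 s.2)

theorem lift_perm_foldl (w : Word Q0Gen) (s : NForm) :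
    FreeGroup.lift NForm.perm (FreeGroup.mk w) (w.foldl (fun s x => s.step x) s) = s := by
  rw [FreeGroup.lift_mk]
  induction w generalizing s with
  | nil => rfl
  | cons x w ih =>
    rw [List.map_cons, List.prod_cons, Equiv.Perm.mul_apply, List.foldl_cons, ih]
    obtain ⟨x, _ | _⟩ := x
    · exact Subtype.ext (step_step x false s.1 s.2)
    · exact Subtype.ext (step_step x true s.1 s.2)

theorem foldl_step_relator {r : Word Q0Gen} (hr : r ∈ Q0Rels) (s : NForm) :
    r.foldl (fun s x => s.step x) s = s := by
  obtain ⟨⟨st, m⟩, h⟩ := s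
  apply Subtype.ext
  obtain rfl | rfl := hr
  · have h' := step_step .b false (st, m) h
    have hadd : ∀ st' m', step (.b, true) (st', m' + 1) =
        ((step (.b, true) (st', m')).1, (step (.b, true) (st', m')).2 + 2) := by
      rintro (_ | ⟨_ | _ | _, _⟩) m' <;> simp [step] <;> ring
    generalize hs : step (.b, false) (st, m) = s at h'
    obtain ⟨st', m'⟩ := s
    simp only [Bool.not_false] at h'
    simp only [List.foldl, NForm.step, hs, step.eq_1, hadd, h', step.eq_2]
    simp [add_sub_assoc]
  · have h' := step_step .t false (st, m - 1) h
    have hadd : ∀ st' m', step (.t, true) (st', m' + 1) =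
        ((step (.t, true) (st', m')).1, (step (.t, true) (st', m')).2 + 1) := by
      rintro (_ | ⟨_ | _ | _, _⟩) m' <;> simp [step]
      split_ifs <;> simp
    generalize hs : step (.t, false) (st, m - 1) = s at h'
    obtain ⟨st', m'⟩ := s
    simp only [Bool.not_false] at h'
    simp only [List.foldl, NForm.step, step.eq_2, hs, step.eq_1, hadd, h', sub_add_cancel]

theorem foldl_step_of_nullHomotopic {w : Word Q0Gen} (hw : NullHomotopic Q0Rels w) (s : NForm) :
    w.foldl (fun s x => s.step x) s = s := by
  have hle : Subgroup.normalClosure (FreeGroup.mk '' Q0Rels) ≤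
      (FreeGroup.lift NForm.perm).ker := by
    refine Subgroup.normalClosure_le_normal ?_
    rintro _ ⟨r, hr, rfl⟩
    refine Equiv.ext fun s => ?_
    conv_lhs => rw [← foldl_step_relator hr s]
    exact lift_perm_foldl r s
  have h := lift_perm_foldl w s
  rwa [MonoidHom.mem_ker.mp (hle hw), Equiv.Perm.one_apply] at h

theorem length_stackWord_le (st : List NLetter) : (stackWord st).length ≤ 2 * st.length := by
  induction st with
  | nil => simp [stackWord]
  | cons x st ih =>
    have : x.word.length ≤ 2 := by
      obtain _ | _ | (_ | _) := x <;> simp [NLetter.word, apow]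
    simp [stackWord]; omega

theorem length_step_le (x : Q0Gen × Bool) (st : List NLetter) (m : ℤ) :
    (step x (st, m)).1.length ≤ st.length + 1 := by
  obtain ⟨_ | _ | _, _ | _⟩ := x <;> rcases st with _ | ⟨_ | _ | _, st⟩ <;>
    simp only [step] <;> (try split_ifs) <;> simp <;> omega

theorem abs_step_le (x : Q0Gen × Bool) (st : List NLetter) (m : ℤ) :
    |(step x (st, m)).2| ≤ 2 * |m| + 1 := by
  have : ∀ ε : Bool, ε.toInt = 0 ∨ ε.toInt = 1 := by decide
  obtain ⟨_ | _ | _, _ | _⟩ := x <;> rcases st with _ | ⟨_ | _ | ε, st⟩ <;>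
    simp only [step] <;> (try split_ifs) <;> (try have := this ε) <;> grind

theorem conn_step (N : ℕ) (x : Q0Gen × Bool) (st : List NLetter) (m : ℤ)
    (hm : 2 * |m| + 1 < 2 ^ N) :
    Conn Q0Rels (2 * st.length + 6 * N + 30) (stackWord st ++ lword N m ++ [x])
      (stackWord (step x (st, m)).1 ++ lword N (step x (st, m)).2) := by
  have h₁ := neg_abs_le m
  have h₂ := le_abs_self m
  have h₀ := abs_nonneg m
  have lift : ∀ v : Word Q0Gen, Conn Q0Rels (6 * N + 22) (lword N m ++ [x]) v →
      Conn Q0Rels (2 * st.length + 6 * N + 30) (stackWord st ++ lword N m ++ [x])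
        (stackWord st ++ v) := fun v h => by
    have := length_stackWord_le st
    simpa using h.append (L' := 2 * st.length + 6 * N + 30) (stackWord st) [] (by simp; omega)
  have pop : ∀ (st : List NLetter) (y : Q0Gen) (c : Bool) (v : Word Q0Gen),
      v.length ≤ 3 * N + 1 → Conn Q0Rels (2 * (st.length + 1) + 6 * N + 30)
        (stackWord st ++ [(y, c)] ++ ((y, !c) :: v)) (stackWord st ++ v) := fun st y c v hv => by
    have := length_stackWord_le st
    simpa using (Conn.cancel y c).append (L' := 2 * (st.length + 1) + 6 * N + 30)
      (stackWord st) v (by omega)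
  obtain ⟨_ | _ | _, _ | _⟩ := x
  · exact lift _ ((conn_lword_ainv N m (by omega) (by omega)).mono (by omega))
  · exact lift _ ((conn_lword_a N m (by omega) (by omega)).mono (by omega))
  · have hb := conn_lword_binv N m (by omega) (by omega)
    have hmod : apow (decide (m % 2 = 1)).toInt = apow (m % 2) := by
      rcases Int.emod_two_eq_zero_or_one m with h | h <;> simp [h]
    rcases st with _ | ⟨s | _ | ε, st⟩
    · simpa [step, stackWord, NLetter.word, hmod] using lift _ hb
    · simpa [step, stackWord, NLetter.word, hmod] using lift _ hb
    · by_cases h : m % 2 = 0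
      · refine (lift _ hb).trans ?_
        simpa [step, stackWord, NLetter.word, h, apow] using
          pop st b true (lword N (m / 2)) (length_lword_le N _ (by omega) (by omega))
      · have h' : m % 2 = 1 := by omega
        simpa [step, stackWord, NLetter.word, h'] using lift _ hb
    · simpa [step, stackWord, NLetter.word, hmod] using lift _ hb
  · have hb := (conn_lword_b N m (by omega) (by omega)).mono (L' := 6 * N + 22) (by omega)
    rcases st with _ | ⟨s | _ | ε, st⟩
    · simpa [step, stackWord, NLetter.word] using lift _ hb
    · simpa [step, stackWord, NLetter.word] using lift _ hb
    · simpa [step, stackWord, NLetter.word] using lift _ hb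
    · refine (lift _ hb).trans ?_
      have hl := length_stackWord_le st
      cases ε
      · simpa [step, stackWord, NLetter.word, apow] using
          pop st b false (lword N (2 * m)) (length_lword_le N _ (by omega) (by omega))
      · have h := length_lword_le N (2 * m) (by omega) (by omega)
        have c₁ := (Conn.cancel (R := Q0Rels) b false).append
          (L' := 2 * (st.length + 1) + 6 * N + 30) (stackWord st ++ [(a, true)])
          (lword N (2 * m)) (by simp; omega)
        have c₂ := (conn_a_lword N (2 * m) (by omega) (by omega)).append
          (L' := 2 * (st.length + 1) + 6 * N + 30) (stackWord st) [] (by simp; omega)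
        simpa [step, stackWord, NLetter.word, apow] using
          Conn.trans (by simpa using c₁) (by simpa using c₂)
  all_goals
    refine (lift _ ((conn_lword_t N m _ (by omega) (by omega)).mono (by omega))).trans ?_
    rcases st with _ | ⟨(_ | _) | _ | ε, st⟩ <;> try
      simpa [step, stackWord, NLetter.word] using Conn.refl _
    exact pop st t _ (lword N m) (length_lword_le N _ (by omega) (by omega))

theorem conn_foldl_step (N : ℕ) (w : Word Q0Gen) (st : List NLetter) (m : ℤ) (i : ℕ)
    (hi : i + w.length ≤ N) (hst : st.length ≤ i) (hm : |m| < 2 ^ i) :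
    Conn Q0Rels (9 * N + 30) (stackWord st ++ lword N m ++ w)
      (stackWord (w.foldl (fun s x => step x s) (st, m)).1 ++
        lword N (w.foldl (fun s x => step x s) (st, m)).2) := by
  induction w generalizing st m i with
  | nil => simpa using Conn.refl _
  | cons x w ih =>
    simp only [List.length_cons] at hi
    have hpow : (2 : ℤ) ^ (i + 1) ≤ 2 ^ N := pow_le_pow_right₀ (by norm_num) (by omega)
    have h₁ := length_step_le x st m
    have h₂ := abs_step_le x st m
    have c := (conn_step N x st m (by omega)).append (L' := 9 * N + 30) [] w (by simp; omega)
    have c' := ih (step x (st, m)).1 (step x (st, m)).2 (i + 1) (by omega) (by omega) (by omega)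
    simp only [List.append_assoc, List.nil_append, List.cons_append, List.foldl_cons] at c c' ⊢
    exact c.trans c'

end Q0

theorem Q0_FL_linear :
    ∃ C : ℕ, 0 < C ∧ ∀ w : Word Q0Gen, NullHomotopic Q0Rels w →
      FLle Q0Rels w (C * w.length + C) := by
  refine ⟨30, by norm_num, fun w hw => ?_⟩
  have hval : ∀ (w : Word Q0Gen) (s : Q0.NForm), (w.foldl (fun s x => s.step x) s).1 =
      w.foldl (fun s x => Q0.step x s) s.1 := by
    intro w
    induction w with
    | nil => exact fun _ => rfl
    | cons x w ih => exact fun s => ih _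
  have hfix := congrArg Subtype.val (Q0.foldl_step_of_nullHomotopic hw ⟨([], 0), List.isChain_nil⟩)
  rw [hval] at hfix
  have c := Q0.conn_foldl_step w.length w [] 0 0 (by omega) (by simp) (by simp)
  have c₀ := Q0.conn_lword_zero w.length
  have c₁ := c₀.append (L' := 30 * w.length + 30) [] w (by simp; omega)
  rw [hfix] at c
  simp only [Q0.stackWord, List.nil_append] at c c₁
  exact Conn.fLle (c₁.symm.trans ((c.mono (by omega)).trans (c₀.mono (by omega)))) (by omega)
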